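/- arXiv:2412.06070 — 2 statements merged into one kernel-verified Lean document; each statement's English description precedes it below -/
import Mathlib

section
/- Let F : ℝ^m → ℝ satisfy the Łojasiewicz condition, and let K ⊆ ℝ^m be a compact set such that {θ : ∇F(θ) = 0} ∩ K ≠ ∅. Then there exist β ∈ (0,1) and ζ > 0 such that for every θ⋆ ∈ {θ : ∇F(θ) = 0} ∩ K there exists an open neighborhood 𝒱 of θ⋆ with |F(θ) − F(θ⋆)|^β ≤ ζ‖∇F(θ)‖ for all θ ∈ 𝒱. -/
open MeasureTheory Filter Topology RealInnerProductSpace Asymptotics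

/-- Near `x`, the inequality `|F θ - F x| ^ β ≤ ζ * ‖∇F θ‖` persists when `β` and `ζ` increase. -/
lemma eventually_lojasiewicz_mono {E : Type*} [NormedAddCommGroup E] [InnerProductSpace ℝ E]
    [CompleteSpace E] {F : E → ℝ} {x : E} (hF : ContinuousAt F x) {β β' ζ ζ' : ℝ}
    (hβ : 0 ≤ β) (hββ' : β ≤ β') (hζζ' : ζ ≤ ζ')
    (h : ∀ᶠ θ in 𝓝 x, |F θ - F x| ^ β ≤ ζ * ‖gradient F θ‖) :
    ∀ᶠ θ in 𝓝 x, |F θ - F x| ^ β' ≤ ζ' * ‖gradient F θ‖ := by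
  filter_upwards [h, hF.eventually (Metric.ball_mem_nhds (F x) one_pos)] with θ hθ hball
  have hle : |F θ - F x| ≤ 1 := by
    simpa [Real.dist_eq] using (Metric.mem_ball.mp hball).le
  calc |F θ - F x| ^ β' ≤ |F θ - F x| ^ β :=
        Real.rpow_le_rpow_of_exponent_ge' (abs_nonneg _) hle hβ hββ'
    _ ≤ ζ * ‖gradient F θ‖ := hθ
    _ ≤ ζ' * ‖gradient F θ‖ := by gcongr

/-- The critical set of a continuously differentiable function is closed. -/
lemma isClosed_setOf_gradient_eq_zero {E : Type*} [NormedAddCommGroup E] [InnerProductSpace ℝ E]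
    [CompleteSpace E] {F : E → ℝ} (hF : ContDiff ℝ 1 F) : IsClosed {θ | gradient F θ = 0} := by
  have hcont : Continuous (gradient F) :=
    (InnerProductSpace.toDual ℝ E).symm.continuous.comp (hF.continuous_fderiv one_ne_zero)
  exact isClosed_eq hcont continuous_const

theorem prop_uniform_lojasiewicz_on_compact
    {m : ℕ} (hm : 1 ≤ m)
    (F : EuclideanSpace ℝ (Fin m) → ℝ)
    (hF : ContDiff ℝ 1 F)
    (hLoj : ∀ θstar : EuclideanSpace ℝ (Fin m), gradient F θstar = 0 →
      ∃ V : Set (EuclideanSpace ℝ (Fin m)), IsOpen V ∧ θstar ∈ V ∧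
        ∃ β ∈ Set.Ioo (0:ℝ) 1, ∃ ζ : ℝ, 0 < ζ ∧
          ∀ θ ∈ V, |F θ - F θstar| ^ β ≤ ζ * ‖gradient F θ‖)
    (K : Set (EuclideanSpace ℝ (Fin m))) (hK : IsCompact K)
    (hKcrit : ({θ | gradient F θ = 0} ∩ K).Nonempty) :
    ∃ β ∈ Set.Ioo (0:ℝ) 1, ∃ ζ : ℝ, 0 < ζ ∧
      ∀ θstar ∈ {θ | gradient F θ = 0} ∩ K,
        ∃ V : Set (EuclideanSpace ℝ (Fin m)), IsOpen V ∧ θstar ∈ V ∧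
          ∀ θ ∈ V, |F θ - F θstar| ^ β ≤ ζ * ‖gradient F θ‖ := by
  have hcompact : IsCompact ({θ | gradient F θ = 0} ∩ K) :=
    hK.inter_left (isClosed_setOf_gradient_eq_zero hF)
  have huniform : ∃ β ∈ Set.Ioo (0:ℝ) 1, ∃ ζ : ℝ, 0 < ζ ∧
      ∀ x ∈ {θ | gradient F θ = 0} ∩ K,
        ∀ᶠ θ in 𝓝 x, |F θ - F x| ^ β ≤ ζ * ‖gradient F θ‖ := by
    refine hcompact.induction_on (p := fun s => ∃ β ∈ Set.Ioo (0:ℝ) 1, ∃ ζ : ℝ, 0 < ζ ∧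
      ∀ x ∈ s, ∀ᶠ θ in 𝓝 x, |F θ - F x| ^ β ≤ ζ * ‖gradient F θ‖) ?_ ?_ ?_ ?_
    · exact ⟨1 / 2, by norm_num, 1, one_pos, by simp⟩
    · rintro s t hst ⟨β, hβ, ζ, hζ, h⟩
      exact ⟨β, hβ, ζ, hζ, fun x hx => h x (hst hx)⟩
    · rintro s t ⟨β₁, hβ₁, ζ₁, hζ₁, h₁⟩ ⟨β₂, hβ₂, ζ₂, hζ₂, h₂⟩
      refine ⟨max β₁ β₂, ⟨lt_max_of_lt_left hβ₁.1, max_lt hβ₁.2 hβ₂.2⟩, max ζ₁ ζ₂,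
        lt_max_of_lt_left hζ₁, ?_⟩
      rintro x (hx | hx)
      · exact eventually_lojasiewicz_mono hF.continuous.continuousAt hβ₁.1.le
          (le_max_left _ _) (le_max_left _ _) (h₁ x hx)
      · exact eventually_lojasiewicz_mono hF.continuous.continuousAt hβ₂.1.le
          (le_max_right _ _) (le_max_right _ _) (h₂ x hx)
    · intro x hx
      obtain ⟨V, hV, hxV, β, hβ, ζ, hζ, h⟩ := hLoj x hx.1
      refine ⟨V ∩ ({θ | gradient F θ = 0} ∩ K),
        inter_mem (mem_nhdsWithin_of_mem_nhds (hV.mem_nhds hxV)) self_mem_nhdsWithin,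
        β, hβ, ζ, hζ, ?_⟩
      rintro y ⟨hyV, hy, -⟩
      -- `F` is constant on the critical points of `V`.
      have hFy : F y = F x := by
        have hle : |F y - F x| ^ β ≤ 0 := by
          simpa [show gradient F y = 0 from hy] using h y hyV
        have hzero := (Real.rpow_eq_zero (abs_nonneg _) hβ.1.ne').mp
          (hle.antisymm (Real.rpow_nonneg (abs_nonneg _) _))
        exact sub_eq_zero.mp (abs_eq_zero.mp hzero)
      filter_upwards [hV.mem_nhds hyV] with θ hθ
      rw [hFy]
      exact h θ hθ
  obtain ⟨β, hβ, ζ, hζ, h⟩ := huniform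
  refine ⟨β, hβ, ζ, hζ, fun x hx => ?_⟩
  obtain ⟨V, hVsub, hV, hxV⟩ := mem_nhds_iff.mp (h x hx)
  exact ⟨V, hV, hxV, fun θ hθ => hVsub hθ⟩
end

section
/- Let φ : ℝ^m → ℝ be a differentiable function whose gradient ∇φ is (L,α)-Hölder continuous for some L > 0 and α ∈ (0,1], i.e. ‖∇φ(θ') − ∇φ(θ)‖ ≤ L‖θ' − θ‖^α for all θ, θ' ∈ ℝ^m, and assume φ is lower bounded (inf φ > −∞). Then for all θ ∈ ℝ^m, ‖∇φ(θ)‖^{(1+α)/α} ≤ ((1+α) L^{1/α} / α) (φ(θ) − inf φ). -/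
/-- The descent inequality for a function with Hölder continuous gradient, along a unit vector. -/
theorem apply_sub_smul_le_of_gradient_holder {F : Type*} [NormedAddCommGroup F]
    [InnerProductSpace ℝ F] [CompleteSpace F] {φ : F → ℝ} (hφ : Differentiable ℝ φ) {L α : ℝ}
    (hα : 0 < α) (hHolder : ∀ x y : F, ‖gradient φ y - gradient φ x‖ ≤ L * ‖y - x‖ ^ α)
    (x : F) {u : F} (hu : ‖u‖ = 1) {t : ℝ} (ht : 0 ≤ t) :
    φ (x - t • u) ≤ φ x - t * inner ℝ (gradient φ x) u + L * t ^ (1 + α) / (1 + α) := by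
  have hα1 : 1 + α ≠ 0 := by positivity
  have hderiv : ∀ s : ℝ, HasDerivAt
      (fun s : ℝ => φ (x - s • u) + s * inner ℝ (gradient φ x) u - L * s ^ (1 + α) / (1 + α))
      (-inner ℝ (gradient φ (x - s • u)) u + inner ℝ (gradient φ x) u - L * s ^ α) s := by
    intro s
    have hline : HasDerivAt (fun s : ℝ => x - s • u) (-u) s := by
      simpa using ((hasDerivAt_id s).smul_const u).const_sub x
    have hcomp := (hφ (x - s • u)).hasGradientAt.hasFDerivAt.comp_hasDerivAt s hline
    have hpow := ((Real.hasDerivAt_rpow_const (x := s) (p := 1 + α)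
      (Or.inr (by linarith))).const_mul L).div_const (1 + α)
    have hlin := (hasDerivAt_id s).mul_const (inner ℝ (gradient φ x) u)
    refine ((hcomp.add hlin).sub hpow).congr_deriv ?_
    simp only [InnerProductSpace.toDual_apply_apply, inner_neg_right, one_mul,
      add_sub_cancel_left]
    field_simp
  have hanti := antitoneOn_of_deriv_nonpos (convex_Ici (0 : ℝ))
    (fun s _ => (hderiv s).continuousAt.continuousWithinAt)
    (fun s _ => (hderiv s).differentiableAt.differentiableWithinAt)
    (fun s hs => by
      rw [interior_Ici, Set.mem_Ioi] at hs
      rw [(hderiv s).deriv]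
      have hgrad := hHolder (x - s • u) x
      have hinner := real_inner_le_norm (gradient φ x - gradient φ (x - s • u)) u
      rw [sub_sub_cancel, norm_smul, hu, Real.norm_of_nonneg hs.le, mul_one] at hgrad
      rw [inner_sub_left, hu, mul_one] at hinner
      linarith)
  have h := hanti Set.self_mem_Ici ht ht
  simp only [zero_smul, sub_zero, zero_mul, add_zero, Real.zero_rpow hα1, mul_zero,
    zero_div] at h
  linarith

theorem lem_holder_gradient_bound
    {m : ℕ} (hm : 1 ≤ m)
    (φ : EuclideanSpace ℝ (Fin m) → ℝ)
    (hφdiff : Differentiable ℝ φ)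
    (L α : ℝ) (hL : 0 < L) (hα : α ∈ Set.Ioc (0:ℝ) 1)
    (hHolder : ∀ θ θ' : EuclideanSpace ℝ (Fin m),
      ‖gradient φ θ' - gradient φ θ‖ ≤ L * ‖θ' - θ‖ ^ α)
    (hφbdd : BddBelow (Set.range φ)) :
    ∀ θ : EuclideanSpace ℝ (Fin m),
      ‖gradient φ θ‖ ^ ((1 + α) / α) ≤
        ((1 + α) * L ^ (1 / α) / α) * (φ θ - sInf (Set.range φ)) := by
  intro θ
  have hα0 : 0 < α := hα.1
  have hinf : ∀ y, sInf (Set.range φ) ≤ φ y := fun y => csInf_le hφbdd ⟨y, rfl⟩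
  rcases eq_or_ne (gradient φ θ) 0 with h0 | h0
  · rw [h0, norm_zero, Real.zero_rpow (by positivity)]
    exact mul_nonneg (by positivity) (sub_nonneg.2 (hinf θ))
  set G := ‖gradient φ θ‖ with hG
  have hGpos : 0 < G := norm_pos_iff.2 h0
  have hu : ‖G⁻¹ • gradient φ θ‖ = 1 := norm_smul_inv_norm (𝕜 := ℝ) h0
  set t := (G / L) ^ (1 / α) with ht
  have htpos : 0 < t := by positivity
  have hdesc := apply_sub_smul_le_of_gradient_holder hφdiff hα0 hHolder θ hu htpos.le
  have hin : inner ℝ (gradient φ θ) (G⁻¹ • gradient φ θ) = G := by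
    rw [real_inner_smul_right, real_inner_self_eq_norm_sq, ← hG]
    field_simp
  have htα : L * t ^ (1 + α) = t * G := by
    rw [Real.rpow_add htpos, Real.rpow_one, ht, ← Real.rpow_mul (by positivity),
      one_div_mul_cancel hα0.ne', Real.rpow_one]
    field_simp
  have hpow : G ^ ((1 + α) / α) = L ^ (1 / α) * (t * G) := by
    rw [ht, Real.div_rpow hGpos.le hL.le, add_div, div_self hα0.ne', Real.rpow_add hGpos,
      Real.rpow_one]
    field_simp
  rw [hin, htα] at hdesc
  have hgap : t * G - t * G / (1 + α) ≤ φ θ - sInf (Set.range φ) := by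
    linarith [hinf (θ - t • G⁻¹ • gradient φ θ)]
  calc G ^ ((1 + α) / α)
      = ((1 + α) * L ^ (1 / α) / α) * (t * G - t * G / (1 + α)) := by
        rw [hpow]
        field_simp
        ring
    _ ≤ _ := by gcongr
end
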